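/- arXiv:1601.05917 — 4 statements merged into one kernel-verified Lean document; each statement's English description precedes it below -/
import Mathlib

section
/- Let W be a BCSI with binary input alphabet X = {0,1} and finite output alphabets Y₁, Y₂, let P_X be a pmf on {0,1}, and let (X,Y₁,Y₂) have joint pmf P_X(x)·W(y₁,y₂|x). Let (R₀,R₁,R₂) be nonnegative reals with R₀ + R₁ ≤ I(X;Y₁) and R₀ + R₂ ≤ I(X;Y₂), and fix β ∈ (0,1/2). Then for every δ > 0 there exist a block length n and an (M₀,M₁,M₂,n) code such that (log₂ Mᵢ)/n ≥ Rᵢ − δ for i = 0,1,2 and P_e ≤ 2^{−n^β}. -/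
open scoped BigOperators

noncomputable section

/-- A probability mass function on a finite type. -/
def IsPMF {α : Type*} [Fintype α] (p : α → ℝ) : Prop :=
  (∀ a, 0 ≤ p a) ∧ ∑ a, p a = 1

/-- Shannon entropy (base 2), with the convention `0 * log₂ 0 = 0`. -/
def ent {α : Type*} [Fintype α] (p : α → ℝ) : ℝ :=
  -∑ a, p a * Real.logb 2 (p a)

/-- Marginal of a joint pmf on the second component. -/
def margSnd {α β : Type*} [Fintype α] [Fintype β] (p : α × β → ℝ) : β → ℝ :=
  fun b => ∑ a, p (a, b)

/-- Marginal of a joint pmf on the first component. -/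
def margFst {α β : Type*} [Fintype α] [Fintype β] (p : α × β → ℝ) : α → ℝ :=
  fun a => ∑ b, p (a, b)

/-- Conditional entropy H(X|Y) of a joint pmf on α × β
(terms with `p (a, b) = 0` vanish since `0 * log₂ _ = 0`). -/
def condEnt {α β : Type*} [Fintype α] [Fintype β] (p : α × β → ℝ) : ℝ :=
  -∑ a, ∑ b, p (a, b) * Real.logb 2 (p (a, b) / margSnd p b)

/-- Mutual information I(X;Y) = H(X) - H(X|Y) of a joint pmf on α × β. -/
def mutInfo {α β : Type*} [Fintype α] [Fintype β] (p : α × β → ℝ) : ℝ :=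
  ent (margFst p) - condEnt p

/-- Pushforward of a pmf along a map. -/
def pushPMF {α β : Type*} [Fintype α] [DecidableEq β] (p : α → ℝ) (f : α → β) : β → ℝ :=
  fun b => ∑ a, if f a = b then p a else 0

/-- Entropy H(A) of a random variable A on the finite probability space (Ω, p). -/
def entOf {Ω α : Type*} [Fintype Ω] [Fintype α] [DecidableEq α] (p : Ω → ℝ) (A : Ω → α) : ℝ :=
  ent (pushPMF p A)

/-- Conditional entropy H(A|B) of random variables on (Ω, p). -/
def condEntOf {Ω α β : Type*} [Fintype Ω] [Fintype α] [Fintype β] [DecidableEq α] [DecidableEq β]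
    (p : Ω → ℝ) (A : Ω → α) (B : Ω → β) : ℝ :=
  condEnt (pushPMF p (fun ω => (A ω, B ω)))

/-- Mutual information I(A;B) of random variables on (Ω, p). -/
def mutInfoOf {Ω α β : Type*} [Fintype Ω] [Fintype α] [Fintype β] [DecidableEq α] [DecidableEq β]
    (p : Ω → ℝ) (A : Ω → α) (B : Ω → β) : ℝ :=
  entOf p A - condEntOf p A B

/-- Conditional mutual information I(A;B|C) = H(A|C) - H(A|(B,C)). -/
def condMutInfoOf {Ω α β γ : Type*} [Fintype Ω] [Fintype α] [Fintype β] [Fintype γ]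
    [DecidableEq α] [DecidableEq β] [DecidableEq γ]
    (p : Ω → ℝ) (A : Ω → α) (B : Ω → β) (C : Ω → γ) : ℝ :=
  condEntOf p A C - condEntOf p A (fun ω => (B ω, C ω))

/-- Bhattacharyya parameter Z(X|Y) = 2 ∑_y √(p(0,y) p(1,y)) for binary X. -/
def bhat {β : Type*} [Fintype β] (p : ZMod 2 × β → ℝ) : ℝ :=
  2 * ∑ b, Real.sqrt (p (0, b) * p (1, b))

/-- Average error probability of an (M₀,M₁,M₂,n) code for a two-receiver broadcast
channel with receiver message side information: messages are uniform, the channel is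
memoryless, and an error occurs if either decoder fails. -/
def PeBC {Xc Y1 Y2 : Type*} [Fintype Xc] [Fintype Y1] [Fintype Y2]
    (W : Xc → Y1 × Y2 → ℝ) {M0 M1 M2 n : ℕ}
    (enc : Fin M0 × Fin M1 × Fin M2 → Fin n → Xc)
    (dec1 : (Fin n → Y1) × Fin M2 → Fin M0 × Fin M1)
    (dec2 : (Fin n → Y2) × Fin M1 → Fin M0 × Fin M2) : ℝ :=
  (1 / ((M0 : ℝ) * M1 * M2)) * ∑ m : Fin M0 × Fin M1 × Fin M2,
    ∑ y : (Fin n → Y1) × (Fin n → Y2),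
      (∏ i, W (enc m i) (y.1 i, y.2 i)) *
        (if dec1 (y.1, m.2.2) ≠ (m.1, m.2.1) ∨ dec2 (y.2, m.2.1) ≠ (m.1, m.2.2)
          then 1 else 0)

section RandomCoding

/-- Sums of products over a function type factor. -/
lemma sum_pi_prod {ι α : Type*} [Fintype ι] [DecidableEq ι] [Fintype α] (g : ι → α → ℝ) :
    ∑ f : ι → α, ∏ i, g i (f i) = ∏ i, ∑ a, g i a := by
  rw [Finset.prod_univ_sum, Fintype.piFinset_univ]

lemma sum_pi_weight_one {ι α : Type*} [Fintype ι] [DecidableEq ι] [Fintype α]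
    {Q : α → ℝ} (hQ : IsPMF Q) (m : ι) (F : α → ℝ) :
    ∑ f : ι → α, (∏ i, Q (f i)) * F (f m) = ∑ a, Q a * F a := by
  classical
  have h : ∀ f : ι → α, (∏ i, Q (f i)) * F (f m)
      = ∏ i, Q (f i) * (if i = m then F (f i) else 1) := by
    intro f
    rw [Finset.prod_mul_distrib, Fintype.prod_ite_eq']
  simp_rw [h]
  rw [sum_pi_prod (fun i a => Q a * (if i = m then F a else 1)),
    ← Fintype.prod_ite_eq' m (fun _ => ∑ a, Q a * F a)]
  refine Finset.prod_congr rfl fun i _ => ?_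
  split_ifs <;> simp [hQ.2]

lemma sum_pi_weight_two_mul {ι α : Type*} [Fintype ι] [DecidableEq ι] [Fintype α]
    {Q : α → ℝ} (hQ : IsPMF Q) {m m' : ι} (hm : m' ≠ m) (F G : α → ℝ) :
    ∑ f : ι → α, (∏ i, Q (f i)) * (F (f m) * G (f m'))
      = (∑ a, Q a * F a) * ∑ a, Q a * G a := by
  classical
  have h : ∀ f : ι → α, (∏ i, Q (f i)) * (F (f m) * G (f m'))
      = ∏ i, Q (f i) * ((if i = m then F (f i) else 1) * (if i = m' then G (f i) else 1)) := by
    intro f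
    rw [Finset.prod_mul_distrib, Finset.prod_mul_distrib, Fintype.prod_ite_eq',
      Fintype.prod_ite_eq']
  simp_rw [h]
  rw [sum_pi_prod (fun i a => Q a * ((if i = m then F a else 1) * (if i = m' then G a else 1))),
    ← Fintype.prod_ite_eq' m (fun _ => ∑ a, Q a * F a),
    ← Fintype.prod_ite_eq' m' (fun _ => ∑ a, Q a * G a), ← Finset.prod_mul_distrib]
  refine Finset.prod_congr rfl fun i _ => ?_
  split_ifs with h1 h2
  · exact absurd (h2.symm.trans h1) hm
  all_goals simp [hQ.2]

/-- The output distribution of a channel `V` with input distribution `Q`. -/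
def outPMF {α β : Type*} [Fintype α] (Q : α → ℝ) (V : α → β → ℝ) : β → ℝ :=
  fun b => ∑ a, Q a * V a b

open Classical in
/-- The probability that the transmitted letter fails the threshold test `T * P b ≤ V a b`. -/
def missProb {α β : Type*} [Fintype α] [Fintype β] (Q : α → ℝ) (V : α → β → ℝ) (T : ℝ) : ℝ :=
  ∑ a, Q a * ∑ b, V a b * (if T * outPMF Q V b ≤ V a b then 0 else 1)

lemma sum_false_alarm_le {α β : Type*} [Fintype α] [Fintype β] {Q : α → ℝ} (hQ : IsPMF Q)
    {V : α → β → ℝ} (hV : ∀ a, IsPMF (V a)) {T : ℝ} (hT : 0 < T)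
    [∀ a b, Decidable (T * outPMF Q V b ≤ V a b)] :
    ∑ b, outPMF Q V b * ∑ a, Q a * (if T * outPMF Q V b ≤ V a b then 1 else 0) ≤ 1 / T := by
  have h : ∀ b a, outPMF Q V b * (Q a * (if T * outPMF Q V b ≤ V a b then 1 else 0))
      ≤ Q a * V a b * (1 / T) := by
    intro b a
    have h1 := hQ.1 a
    have h2 := (hV a).1 b
    split_ifs with h
    · have : outPMF Q V b ≤ V a b * (1 / T) := by
        rw [mul_one_div, le_div_iff₀ hT]; linarith
      nlinarith
    · rw [mul_zero, mul_zero]; positivity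
  calc _ ≤ ∑ b, ∑ a, Q a * V a b * (1 / T) := by
        refine Finset.sum_le_sum fun b _ => ?_
        rw [Finset.mul_sum]
        exact Finset.sum_le_sum fun a _ => h b a
    _ = (∑ a, Q a * ∑ b, V a b) * (1 / T) := by
        rw [Finset.sum_comm, Finset.sum_mul]
        refine Finset.sum_congr rfl fun a _ => ?_
        rw [Finset.mul_sum, Finset.sum_mul]
    _ = 1 / T := by simp [(hV _).2, hQ.2]

/-- Threshold decoding of message `m` among the competitors `J` fails. -/
def ThresholdFails {α β μ : Type*} [Fintype α] (Q : α → ℝ) (V : α → β → ℝ) (T : ℝ)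
    (enc : μ → α) (J : Finset μ) (m : μ) (b : β) : Prop :=
  ¬ T * outPMF Q V b ≤ V (enc m) b ∨ ∃ m' ∈ J, T * outPMF Q V b ≤ V (enc m') b

open Classical in
lemma expected_threshold_error_le {α β μ : Type*} [Fintype α] [Fintype β] [Fintype μ]
    [DecidableEq μ] {Q : α → ℝ} (hQ : IsPMF Q) {V : α → β → ℝ} (hV : ∀ a, IsPMF (V a)) {T : ℝ}
    (hT : 0 < T) (m : μ) (J : Finset μ) (hJ : m ∉ J) :
    ∑ enc : μ → α, (∏ k, Q (enc k)) *
        ∑ b, V (enc m) b * (if ThresholdFails Q V T enc J m b then 1 else 0)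
      ≤ missProb Q V T + J.card / T := by
  have hpt : ∀ (enc : μ → α) (b : β),
      V (enc m) b * (if ThresholdFails Q V T enc J m b then (1 : ℝ) else 0)
      ≤ V (enc m) b * (if T * outPMF Q V b ≤ V (enc m) b then 0 else 1)
        + ∑ m' ∈ J, V (enc m) b * (if T * outPMF Q V b ≤ V (enc m') b then 1 else 0) := by
    intro enc b
    rw [← Finset.mul_sum, ← mul_add]
    refine mul_le_mul_of_nonneg_left ?_ ((hV _).1 b)
    have hnn : ∀ m' ∈ J, (0 : ℝ) ≤ if T * outPMF Q V b ≤ V (enc m') b then 1 else 0 := by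
      intro m' _; split_ifs <;> norm_num
    have hs := Finset.sum_nonneg hnn
    by_cases hE : ThresholdFails Q V T enc J m b
    · rw [if_pos hE]
      rcases hE with h | ⟨m', hm', h⟩
      · rw [if_neg h]; linarith
      · have := Finset.single_le_sum hnn hm'
        rw [if_pos h] at this
        have : (0 : ℝ) ≤ if T * outPMF Q V b ≤ V (enc m) b then 0 else 1 := by
          split_ifs <;> norm_num
        linarith
    · rw [if_neg hE]
      have : (0 : ℝ) ≤ if T * outPMF Q V b ≤ V (enc m) b then 0 else 1 := by
        split_ifs <;> norm_num
      linarith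
  have hw : ∀ enc : μ → α, 0 ≤ ∏ k, Q (enc k) := fun enc => Finset.prod_nonneg fun k _ => hQ.1 _
  have hfalse : ∀ m' ∈ J, ∑ enc : μ → α, (∏ k, Q (enc k)) *
      ∑ b, V (enc m) b * (if T * outPMF Q V b ≤ V (enc m') b then 1 else 0) ≤ 1 / T := by
    intro m' hm'
    have hne : m' ≠ m := fun h => hJ (h ▸ hm')
    refine le_trans (le_of_eq ?_) (sum_false_alarm_le hQ hV hT)
    simp_rw [Finset.mul_sum]
    rw [Finset.sum_comm]
    refine Finset.sum_congr rfl fun b _ => ?_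
    rw [sum_pi_weight_two_mul hQ hne (fun a => V a b)
      (fun a => if T * outPMF Q V b ≤ V a b then 1 else 0), ← Finset.mul_sum]
    rfl
  calc _ ≤ ∑ enc : μ → α, (∏ k, Q (enc k)) *
        ((∑ b, V (enc m) b * (if T * outPMF Q V b ≤ V (enc m) b then 0 else 1))
        + ∑ m' ∈ J, ∑ b, V (enc m) b * (if T * outPMF Q V b ≤ V (enc m') b then 1 else 0)) := by
        refine Finset.sum_le_sum fun enc _ => mul_le_mul_of_nonneg_left ?_ (hw enc)
        rw [Finset.sum_comm, ← Finset.sum_add_distrib]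
        exact Finset.sum_le_sum fun b _ => hpt enc b
    _ = missProb Q V T + ∑ m' ∈ J, ∑ enc : μ → α, (∏ k, Q (enc k)) *
          ∑ b, V (enc m) b * (if T * outPMF Q V b ≤ V (enc m') b then 1 else 0) := by
        simp_rw [mul_add]
        rw [Finset.sum_add_distrib, sum_pi_weight_one hQ m
          (fun a => ∑ b, V a b * (if T * outPMF Q V b ≤ V a b then 0 else 1))]
        congr 1
        rw [Finset.sum_comm]
        exact Finset.sum_congr rfl fun enc _ => by rw [Finset.mul_sum]
    _ ≤ missProb Q V T + J.card / T := by
        have := Finset.sum_le_sum hfalse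
        rw [Finset.sum_const, nsmul_eq_mul, mul_one_div] at this
        linarith

lemma exists_le_of_weighted_sum_le {α : Type*} [Fintype α] {w : α → ℝ} (hw : IsPMF w)
    {F : α → ℝ} {B : ℝ} (h : ∑ a, w a * F a ≤ B) : ∃ a, F a ≤ B := by
  by_contra! hc
  have h1 : ∑ a, w a * (F a - B) ≤ 0 := by
    simp_rw [mul_sub]
    rw [Finset.sum_sub_distrib, ← Finset.sum_mul, hw.2]; linarith
  have h2 : ∀ a ∈ Finset.univ, 0 ≤ w a * (F a - B) := fun a _ =>
    mul_nonneg (hw.1 a) (by linarith [hc a])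
  have h3 := (Finset.sum_eq_zero_iff_of_nonneg h2).1 (le_antisymm h1 (Finset.sum_nonneg h2))
  have h4 : ∑ a, w a = 0 := Finset.sum_eq_zero fun a ha =>
    (mul_eq_zero.1 (h3 a ha)).resolve_right (by linarith [hc a])
  rw [hw.2] at h4
  exact one_ne_zero h4

end RandomCoding

section Memoryless

/-- The product pmf of `n` independent copies. -/
def powPMF {α : Type*} (n : ℕ) (Q : α → ℝ) : (Fin n → α) → ℝ := fun x => ∏ i, Q (x i)

/-- The `n`-fold memoryless extension of a channel. -/
def powChan {α β : Type*} (n : ℕ) (V : α → β → ℝ) : (Fin n → α) → (Fin n → β) → ℝ :=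
  fun x y => ∏ i, V (x i) (y i)

lemma isPMF_pi {ι α : Type*} [Fintype ι] [DecidableEq ι] [Fintype α] {g : ι → α → ℝ}
    (hg : ∀ i, IsPMF (g i)) : IsPMF (fun f : ι → α => ∏ i, g i (f i)) :=
  ⟨fun f => Finset.prod_nonneg fun i _ => (hg i).1 _, by
    rw [sum_pi_prod]; exact Finset.prod_eq_one fun i _ => (hg i).2⟩

lemma outPMF_pow {α β : Type*} [Fintype α] (n : ℕ) (Q : α → ℝ) (V : α → β → ℝ) (y : Fin n → β) :
    outPMF (powPMF n Q) (powChan n V) y = ∏ i, outPMF Q V (y i) := by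
  simp only [outPMF, powPMF, powChan, ← Finset.prod_mul_distrib]
  rw [sum_pi_prod (fun i a => Q a * V a (y i))]

lemma exists_exp_tilt_lt_one {α : Type*} [Fintype α] {p : α → ℝ} (hp : IsPMF p) (c : α → ℝ)
    (hc : ∑ a, p a * c a < 0) : ∃ s > 0, ∑ a, p a * Real.exp (s * c a) < 1 := by
  have hd : HasDerivAt (fun s : ℝ => ∑ a, p a * Real.exp (s * c a)) (∑ a, p a * c a) 0 := by
    apply HasDerivAt.fun_sum
    intro a _
    have h := ((((hasDerivAt_id (0 : ℝ)).mul_const (c a))).exp).const_mul (p a)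
    simpa using h
  have hs := hd.tendsto_slope_zero_right
  have hev := (hs.eventually (gt_mem_nhds hc)).and self_mem_nhdsWithin
  obtain ⟨s, h1, h2⟩ := hev.exists
  have h2 : 0 < s := h2
  refine ⟨s, h2, ?_⟩
  simp only [zero_add, zero_mul, Real.exp_zero, mul_one, hp.2, smul_eq_mul] at h1
  by_contra! h
  have := mul_nonneg (inv_pos.2 h2).le (sub_nonneg.2 h)
  linarith

lemma exists_missProb_pow_le {α β : Type*} [Fintype α] [Fintype β] {Q : α → ℝ} (hQ : IsPMF Q)
    {V : α → β → ℝ} (hV : ∀ a, IsPMF (V a)) {t : ℝ}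
    (ht : t < ∑ a, ∑ b, Q a * V a b * Real.log (V a b / outPMF Q V b)) :
    ∃ ρ, 0 ≤ ρ ∧ ρ < 1 ∧ ∀ n, missProb (powPMF n Q) (powChan n V) (Real.exp t ^ n) ≤ ρ ^ n := by
  classical
  set P := outPMF Q V with hP
  have hnn : ∀ a b, 0 ≤ Q a * V a b := fun a b => mul_nonneg (hQ.1 a) ((hV a).1 b)
  have hjoint : IsPMF (fun z : α × β => Q z.1 * V z.1 z.2) := by
    refine ⟨fun z => hnn _ _, ?_⟩
    rw [Fintype.sum_prod_type]
    simp [← Finset.mul_sum, (hV _).2, hQ.2]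
  obtain ⟨s, hs, hlt⟩ := exists_exp_tilt_lt_one hjoint
    (fun z => t - Real.log (V z.1 z.2 / P z.2)) (by
      simp_rw [mul_sub]
      rw [Finset.sum_sub_distrib, ← Finset.sum_mul, hjoint.2, Fintype.sum_prod_type]
      linarith)
  refine ⟨_, Finset.sum_nonneg fun z _ => mul_nonneg (hnn z.1 z.2) (Real.exp_pos _).le, hlt,
    fun n => ?_⟩
  set F : α → β → ℝ := fun a b => Q a * V a b * Real.exp (s * (t - Real.log (V a b / P b)))
  have hFnn : ∀ a b, 0 ≤ F a b := fun a b => mul_nonneg (hnn a b) (Real.exp_pos _).le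
  have hpt : ∀ (x : Fin n → α) (y : Fin n → β), powPMF n Q x * (powChan n V x y *
      (if Real.exp t ^ n * outPMF (powPMF n Q) (powChan n V) y ≤ powChan n V x y
        then 0 else 1)) ≤ ∏ i, F (x i) (y i) := by
    intro x y
    have hR : 0 ≤ ∏ i, F (x i) (y i) := Finset.prod_nonneg fun i _ => hFnn _ _
    split_ifs with h
    · simpa using hR
    rw [mul_one]
    have hprod : powPMF n Q x * powChan n V x y = ∏ i, Q (x i) * V (x i) (y i) := by
      rw [Finset.prod_mul_distrib]; rfl
    rw [hprod]
    by_cases h0 : ∏ i, Q (x i) * V (x i) (y i) = 0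
    · rw [h0]; exact hR
    have hpos : ∀ i, 0 < Q (x i) * V (x i) (y i) := fun i =>
      lt_of_le_of_ne (hnn _ _) (Ne.symm (Finset.prod_ne_zero_iff.1 h0 i (Finset.mem_univ i)))
    have hVpos : ∀ i, 0 < V (x i) (y i) := fun i =>
      lt_of_le_of_ne ((hV _).1 _) fun h => by have := hpos i; rw [← h] at this; simp at this
    have hPpos : ∀ i, 0 < P (y i) := fun i =>
      lt_of_lt_of_le (hpos i) (Finset.single_le_sum (f := fun a => Q a * V a (y i))
        (fun a _ => hnn a _) (Finset.mem_univ (x i)))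
    simp only [F]
    rw [Finset.prod_mul_distrib (f := fun i => Q (x i) * V (x i) (y i)), ← Real.exp_sum]
    refine le_mul_of_one_le_right (Finset.prod_nonneg fun i _ => hnn _ _) (Real.one_le_exp ?_)
    rw [← Finset.mul_sum]
    refine mul_nonneg hs.le ?_
    have hlog : ∀ i, Real.log (V (x i) (y i) / P (y i))
        = Real.log (V (x i) (y i)) - Real.log (P (y i)) := fun i =>
      Real.log_div (hVpos i).ne' (hPpos i).ne'
    rw [outPMF_pow, powChan, not_le] at h
    have hl := Real.log_lt_log (Finset.prod_pos fun i _ => hVpos i) h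
    rw [Real.log_mul (by positivity) (Finset.prod_pos fun i _ => hPpos i).ne', Real.log_pow,
      Real.log_exp, Real.log_prod (fun i _ => (hVpos i).ne'),
      Real.log_prod (fun i _ => (hPpos i).ne')] at hl
    simp_rw [hlog]
    rw [Finset.sum_sub_distrib, Finset.sum_sub_distrib]
    simp only [Finset.sum_const, Finset.card_univ, Fintype.card_fin, nsmul_eq_mul]
    linarith
  calc missProb (powPMF n Q) (powChan n V) (Real.exp t ^ n)
      ≤ ∑ x : Fin n → α, ∑ y : Fin n → β, ∏ i, F (x i) (y i) := by
        unfold missProb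
        refine Finset.sum_le_sum fun x _ => ?_
        rw [Finset.mul_sum]
        refine Finset.sum_le_sum fun y _ => ?_
        convert hpt x y
    _ = ∏ _i : Fin n, ∑ a, ∑ b, F a b := by
        rw [← sum_pi_prod (fun (_ : Fin n) a => ∑ b, F a b)]
        exact Finset.sum_congr rfl fun x _ => sum_pi_prod (fun i b => F (x i) b)
    _ = _ := by
        rw [Finset.prod_const, Finset.card_univ, Fintype.card_fin, Fintype.sum_prod_type]

end Memoryless

section Marginals

lemma isPMF_pushPMF {α β : Type*} [Fintype α] [Fintype β] [DecidableEq β] {p : α → ℝ}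
    (hp : IsPMF p) (f : α → β) : IsPMF (pushPMF p f) := by
  refine ⟨fun b => Finset.sum_nonneg fun a _ => ?_, ?_⟩
  · split_ifs
    exacts [hp.1 a, le_rfl]
  · unfold pushPMF
    rw [Finset.sum_comm]
    simpa using hp.2

lemma sum_powChan_comp {α γ β : Type*} [Fintype γ] [Fintype β] [DecidableEq β] (n : ℕ)
    (W : α → γ → ℝ) (f : γ → β) (x : Fin n → α) (F : (Fin n → β) → ℝ) :
    ∑ z : Fin n → γ, powChan n W x z * F (fun i => f (z i))
      = ∑ y : Fin n → β, powChan n (fun a => pushPMF (W a) f) x y * F y := by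
  have h : ∀ y : Fin n → β, powChan n (fun a => pushPMF (W a) f) x y
      = ∑ z : Fin n → γ, if (fun i => f (z i)) = y then powChan n W x z else 0 := by
    intro y
    simp only [powChan, pushPMF]
    rw [← sum_pi_prod (fun i c => if f c = y i then W (x i) c else 0)]
    refine Finset.sum_congr rfl fun z _ => ?_
    rw [Finset.prod_ite_zero]
    simp [funext_iff]
  simp_rw [h, Finset.sum_mul]
  rw [Finset.sum_comm]
  simp [ite_mul]

lemma mutInfoOf_input_output {α γ β : Type*} [Fintype α] [Fintype γ] [Fintype β]
    [DecidableEq α] [DecidableEq β] {Q : α → ℝ} (hQ : IsPMF Q) {W : α → γ → ℝ}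
    (hW : ∀ a, IsPMF (W a)) (f : γ → β) :
    mutInfoOf (fun z : α × γ => Q z.1 * W z.1 z.2) (fun ω => ω.1) (fun ω => f ω.2)
      = (∑ a, ∑ b, Q a * pushPMF (W a) f b *
          Real.log (pushPMF (W a) f b / outPMF Q (fun a => pushPMF (W a) f) b)) / Real.log 2 := by
  have hV : ∀ a, IsPMF (pushPMF (W a) f) := fun a => isPMF_pushPMF (hW a) f
  set V : α → β → ℝ := fun a => pushPMF (W a) f with hVdef
  have hj : pushPMF (fun z : α × γ => Q z.1 * W z.1 z.2) (fun ω => (ω.1, f ω.2))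
      = fun z => Q z.1 * V z.1 z.2 := by
    funext ⟨a, b⟩
    simp only [pushPMF, hVdef, Fintype.sum_prod_type, Prod.mk.injEq, ite_and]
    rw [Finset.sum_eq_single a]
    · simp [Finset.mul_sum]
    · intro a' _ h; simp [h]
    · simp
  have hm : pushPMF (fun z : α × γ => Q z.1 * W z.1 z.2) (fun ω => ω.1) = Q := by
    funext a
    simp only [pushPMF, Fintype.sum_prod_type]
    rw [Finset.sum_eq_single a]
    · simp [← Finset.mul_sum, (hW a).2]
    · intro a' _ h; simp [h]
    · simp
  have hmarg : margSnd (fun z : α × β => Q z.1 * V z.1 z.2) = outPMF Q V := rfl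
  unfold mutInfoOf entOf condEntOf
  rw [hj, hm]
  unfold ent condEnt
  rw [hmarg, sub_neg_eq_add, neg_add_eq_sub, ← Finset.sum_sub_distrib, Finset.sum_div]
  refine Finset.sum_congr rfl fun a _ => ?_
  have h1 : Q a * Real.logb 2 (Q a) = ∑ b, Q a * V a b * Real.logb 2 (Q a) := by
    rw [← Finset.sum_mul, ← Finset.mul_sum, (hV a).2, mul_one]
  rw [h1, ← Finset.sum_sub_distrib, Finset.sum_div]
  refine Finset.sum_congr rfl fun b _ => ?_
  change Q a * V a b * Real.logb 2 (Q a * V a b / outPMF Q V b) - _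
    = Q a * V a b * Real.log (V a b / outPMF Q V b) / Real.log 2
  by_cases h0 : Q a * V a b = 0
  · simp [h0]
  have hq : Q a ≠ 0 := left_ne_zero_of_mul h0
  have hv : V a b ≠ 0 := right_ne_zero_of_mul h0
  have hp : outPMF Q V b ≠ 0 := by
    have hle : Q a * V a b ≤ outPMF Q V b :=
      Finset.single_le_sum (f := fun a => Q a * V a b)
        (fun a _ => mul_nonneg (hQ.1 a) ((hV a).1 b)) (Finset.mem_univ a)
    have : 0 < Q a * V a b := lt_of_le_of_ne (mul_nonneg (hQ.1 a) ((hV a).1 b)) (Ne.symm h0)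
    linarith
  rw [mul_div_assoc, Real.logb_mul hq (div_ne_zero hv hp), mul_div_assoc]
  unfold Real.logb
  ring

end Marginals

section Rates

/-- The number of messages at rate `R - δ` (a single message if this is negative). -/
def codeSize (R δ : ℝ) (n : ℕ) : ℕ := ⌈(2 : ℝ) ^ ((n : ℝ) * max (R - δ) 0)⌉₊

lemma codeSize_pos (R δ : ℝ) (n : ℕ) : 0 < codeSize R δ n :=
  Nat.ceil_pos.2 (by positivity)

lemma le_logb_codeSize (R δ : ℝ) {n : ℕ} (hn : 0 < n) :
    R - δ ≤ Real.logb 2 (codeSize R δ n) / n := by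
  have hn' : (0 : ℝ) < n := Nat.cast_pos.2 hn
  refine (le_max_left _ 0).trans ?_
  rw [le_div_iff₀ hn', Real.le_logb_iff_rpow_le (by norm_num)
    (Nat.cast_pos.2 (codeSize_pos R δ n)), mul_comm]
  exact Nat.le_ceil _

lemma codeSize_le (R δ : ℝ) (n : ℕ) :
    (codeSize R δ n : ℝ) ≤ 2 * 2 ^ ((n : ℝ) * max (R - δ) 0) := by
  have h := Nat.ceil_lt_add_one (a := (2 : ℝ) ^ ((n : ℝ) * max (R - δ) 0)) (by positivity)
  have h1 : (1 : ℝ) ≤ 2 ^ ((n : ℝ) * max (R - δ) 0) :=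
    Real.one_le_rpow (by norm_num) (by positivity)
  unfold codeSize
  linarith

lemma codeSize_mul_sub_one_le {R R' I δ : ℝ} (hR : 0 ≤ R) (hR' : 0 ≤ R') (hI : R + R' ≤ I)
    (hδ : 0 < δ) (n : ℕ) :
    ((codeSize R δ n * codeSize R' δ n - 1 : ℕ) : ℝ) / ((2 : ℝ) ^ (I - δ / 2)) ^ n
      ≤ 4 * ((2 : ℝ) ^ (-(δ / 2))) ^ n := by
  by_cases h : R - δ ≤ 0 ∧ R' - δ ≤ 0
  · have h1 : codeSize R δ n = 1 := by simp [codeSize, max_eq_right h.1]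
    have h2 : codeSize R' δ n = 1 := by simp [codeSize, max_eq_right h.2]
    rw [h1, h2]
    simp only [mul_one, Nat.sub_self, Nat.cast_zero, zero_div]
    positivity
  have hsum : max (R - δ) 0 + max (R' - δ) 0 ≤ I - δ := by
    rcases max_cases (R - δ) 0 with ⟨h1, h1'⟩ | ⟨h1, h1'⟩ <;>
    rcases max_cases (R' - δ) 0 with ⟨h2, h2'⟩ | ⟨h2, h2'⟩ <;> rw [h1, h2]
    · linarith
    · linarith
    · linarith
    · exact absurd ⟨h1'.le, h2'.le⟩ h
  rw [div_le_iff₀ (by positivity), mul_assoc, ← mul_pow, ← Real.rpow_add two_pos,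
    ← Real.rpow_natCast, ← Real.rpow_mul two_pos.le]
  calc ((codeSize R δ n * codeSize R' δ n - 1 : ℕ) : ℝ)
      ≤ ((codeSize R δ n * codeSize R' δ n : ℕ) : ℝ) := Nat.cast_le.2 (Nat.sub_le _ _)
    _ ≤ (2 * 2 ^ ((n : ℝ) * max (R - δ) 0)) * (2 * 2 ^ ((n : ℝ) * max (R' - δ) 0)) := by
        rw [Nat.cast_mul]
        exact mul_le_mul (codeSize_le _ _ _) (codeSize_le _ _ _) (Nat.cast_nonneg _)
          (by positivity)
    _ = 4 * 2 ^ ((n : ℝ) * (max (R - δ) 0 + max (R' - δ) 0)) := by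
        rw [mul_add, Real.rpow_add two_pos]; ring
    _ ≤ _ := by
        refine mul_le_mul_of_nonneg_left
          (Real.rpow_le_rpow_of_exponent_le one_le_two ?_) (by norm_num)
        rw [mul_comm]
        exact mul_le_mul_of_nonneg_right (by linarith) (Nat.cast_nonneg n)

lemma eventually_mul_pow_le_two_rpow_neg {b C ρ : ℝ} (hb : b < 1) (hC : 0 < C) (hρ : 0 < ρ)
    (hρ1 : ρ < 1) :
    ∀ᶠ n : ℕ in Filter.atTop, C * ρ ^ n ≤ Real.rpow 2 (-(Real.rpow (n : ℝ) b)) := by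
  have hl : Real.log ρ < 0 := Real.log_neg hρ hρ1
  have hl2 : 0 < Real.log 2 := Real.log_pos (by norm_num)
  have h1 := ((tendsto_rpow_neg_atTop (sub_pos.2 hb)).comp
    (tendsto_natCast_atTop_atTop (R := ℝ))).eventually_le_const
    (u := -Real.log ρ / (2 * Real.log 2)) (div_pos (by linarith) (by linarith))
  have h2 := tendsto_natCast_atTop_atTop (R := ℝ) |>.eventually_ge_atTop
    (2 * Real.log C / (-Real.log ρ))
  filter_upwards [h1, h2, Filter.eventually_gt_atTop 0] with n h1 h2 hn
  have hn : (0 : ℝ) < n := Nat.cast_pos.2 hn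
  simp only [Function.comp_apply] at h1
  have hnb : (n : ℝ) ^ b = (n : ℝ) ^ (-(1 - b)) * n := by
    rw [← Real.rpow_add_one hn.ne']; ring_nf
  change _ ≤ (2 : ℝ) ^ (-((n : ℝ) ^ b))
  rw [← Real.log_le_log_iff (by positivity) (by positivity), Real.log_mul hC.ne' (by positivity),
    Real.log_pow, Real.log_rpow two_pos]
  rw [div_le_iff₀ (by linarith)] at h2
  have h3 : (n : ℝ) ^ b * Real.log 2 ≤ -Real.log ρ * n / 2 := by
    calc (n : ℝ) ^ b * Real.log 2 ≤ (-Real.log ρ / (2 * Real.log 2) * n) * Real.log 2 := by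
          rw [hnb]
          gcongr
      _ = _ := by field_simp
  linarith

end Rates

section Broadcast

lemma exists_receiver_error_bound {α γ β : Type*} [Fintype α] [Fintype γ] [Fintype β]
    [DecidableEq α] [DecidableEq β] {Q : α → ℝ} (hQ : IsPMF Q) {W : α → γ → ℝ}
    (hW : ∀ a, IsPMF (W a)) (f : γ → β) {R R' δ : ℝ} (hR : 0 ≤ R) (hR' : 0 ≤ R')
    (hI : R + R' ≤
      mutInfoOf (fun z : α × γ => Q z.1 * W z.1 z.2) (fun ω => ω.1) (fun ω => f ω.2))
    (hδ : 0 < δ) :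
    ∃ T > 0, ∃ ρ, 0 < ρ ∧ ρ < 1 ∧ ∀ n : ℕ,
      missProb (powPMF n Q) (powChan n fun a => pushPMF (W a) f) (T ^ n)
        + ((codeSize R δ n * codeSize R' δ n - 1 : ℕ) : ℝ) / T ^ n ≤ 5 * ρ ^ n := by
  set I := mutInfoOf (fun z : α × γ => Q z.1 * W z.1 z.2) (fun ω => ω.1) (fun ω => f ω.2) with hId
  have hl2 : 0 < Real.log 2 := Real.log_pos one_lt_two
  obtain ⟨ρ, hρ0, hρ1, hρ⟩ := exists_missProb_pow_le hQ (fun a => isPMF_pushPMF (hW a) f)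
    (t := Real.log 2 * (I - δ / 2)) (by
      rw [mutInfoOf_input_output hQ hW f, eq_div_iff hl2.ne'] at hId
      rw [← hId]
      nlinarith)
  rw [← Real.rpow_def_of_pos two_pos] at hρ
  set σ : ℝ := 2 ^ (-(δ / 2)) with hσ
  have hσ0 : 0 < σ := by positivity
  have hσ1 : σ < 1 := Real.rpow_lt_one_of_one_lt_of_neg one_lt_two (by linarith)
  refine ⟨2 ^ (I - δ / 2), by positivity, max ρ σ, lt_max_of_lt_right hσ0, max_lt hρ1 hσ1,
    fun n => ?_⟩
  have h1 := hρ n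
  have h2 := codeSize_mul_sub_one_le hR hR' hI hδ n
  have h3 : ρ ^ n ≤ max ρ σ ^ n := pow_le_pow_left₀ hρ0 (le_max_left _ _) n
  have h4 : σ ^ n ≤ max ρ σ ^ n := pow_le_pow_left₀ hσ0.le (le_max_right _ _) n
  linarith

/-- Messages other than `m` with the same side information `S` and different wanted part `g`
are at most as many as the other wanted parts. -/
lemma card_competitors_le {μ σ κ : Type*} [Fintype μ] [Fintype κ] [DecidableEq μ] [DecidableEq σ]
    (S : μ → σ) (g : μ → κ) (hinj : ∀ m m', S m = S m' → g m = g m' → m = m') (m : μ) :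
    (Finset.univ.filter fun m' => m' ≠ m ∧ S m' = S m).card ≤ Fintype.card κ - 1 := by
  classical
  rw [← Finset.card_univ, ← Finset.card_erase_of_mem (Finset.mem_univ (g m))]
  refine Finset.card_le_card_of_injOn g ?_ ?_
  · intro m' hm'
    simp only [Finset.coe_filter, Finset.mem_univ, true_and, Set.mem_ofPred_eq] at hm'
    simp only [Finset.coe_erase, Finset.coe_univ, Set.mem_sdiff, Set.mem_univ, true_and,
      Set.mem_singleton_iff]
    exact fun h => hm'.1 (hinj _ _ hm'.2 h)
  · intro m₁ h₁ m₂ h₂ h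
    simp only [Finset.coe_filter, Finset.mem_univ, true_and, Set.mem_ofPred_eq] at h₁ h₂
    exact hinj _ _ (h₁.2.trans h₂.2.symm) h

/-- A threshold decoder knowing the side information `S m` recovers `g m` unless
`ThresholdFails`. -/
lemma exists_threshold_decoder {α β μ σ κ : Type*} [Fintype α] [Fintype μ] [Nonempty κ]
    [DecidableEq μ] [DecidableEq σ] (Q : α → ℝ) (V : α → β → ℝ) (T : ℝ) (enc : μ → α)
    (S : μ → σ) (g : μ → κ) :
    ∃ dec : β × σ → κ, ∀ m b,
      ¬ ThresholdFails Q V T enc (Finset.univ.filter fun m' => m' ≠ m ∧ S m' = S m) m b →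
        dec (b, S m) = g m := by
  classical
  refine ⟨fun z => if h : ∃ m, S m = z.2 ∧ T * outPMF Q V z.1 ≤ V (enc m) z.1 then g h.choose
    else Classical.arbitrary κ, fun m b hE => ?_⟩
  unfold ThresholdFails at hE
  push Not at hE
  have h : ∃ m', S m' = S m ∧ T * outPMF Q V b ≤ V (enc m') b := ⟨m, rfl, hE.1⟩
  simp only [dif_pos h]
  have hs := h.choose_spec
  congr 1
  by_contra hne
  exact absurd hs.2 (not_le.2 (hE.2 _ (by simp [hne, hs.1])))

open Classical in
lemma PeBC_le_of_threshold {Xc Y1 Y2 : Type*} [Fintype Xc] [Fintype Y1] [Fintype Y2]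
    [DecidableEq Y1] [DecidableEq Y2] {W : Xc → Y1 × Y2 → ℝ} (hW : ∀ x, IsPMF (W x))
    {M0 M1 M2 n : ℕ}
    (enc : Fin M0 × Fin M1 × Fin M2 → Fin n → Xc)
    (dec1 : (Fin n → Y1) × Fin M2 → Fin M0 × Fin M1)
    (dec2 : (Fin n → Y2) × Fin M1 → Fin M0 × Fin M2)
    (E1 : Fin M0 × Fin M1 × Fin M2 → (Fin n → Y1) → Prop)
    (E2 : Fin M0 × Fin M1 × Fin M2 → (Fin n → Y2) → Prop)
    (h1 : ∀ m y, ¬ E1 m y → dec1 (y, m.2.2) = (m.1, m.2.1))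
    (h2 : ∀ m y, ¬ E2 m y → dec2 (y, m.2.1) = (m.1, m.2.2)) :
    PeBC W enc dec1 dec2 ≤ (1 / ((M0 : ℝ) * M1 * M2)) * ∑ m,
      ((∑ y, powChan n (fun x => pushPMF (W x) Prod.fst) (enc m) y * (if E1 m y then 1 else 0))
      + ∑ y, powChan n (fun x => pushPMF (W x) Prod.snd) (enc m) y *
          (if E2 m y then 1 else 0)) := by
  unfold PeBC
  refine mul_le_mul_of_nonneg_left (Finset.sum_le_sum fun m _ => ?_) (by positivity)
  rw [← sum_powChan_comp n W Prod.fst (enc m) (fun y => if E1 m y then 1 else 0),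
    ← sum_powChan_comp n W Prod.snd (enc m) (fun y => if E2 m y then 1 else 0),
    ← Finset.sum_add_distrib,
    ← (Equiv.arrowProdEquivProdArrow (Fin n) (fun _ => Y1) (fun _ => Y2)).sum_comp]
  refine Finset.sum_le_sum fun z _ => ?_
  rw [← mul_add]
  refine mul_le_mul_of_nonneg_left ?_ (Finset.prod_nonneg fun i _ => (hW _).1 _)
  change (if dec1 ((fun i => (z i).1), m.2.2) ≠ _ ∨ dec2 ((fun i => (z i).2), m.2.1) ≠ _
    then (1 : ℝ) else 0) ≤ _
  by_cases e1 : E1 m (fun i => (z i).1)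
  · rw [if_pos e1]; split_ifs <;> norm_num
  by_cases e2 : E2 m (fun i => (z i).2)
  · rw [if_pos e2]; split_ifs <;> norm_num
  rw [if_neg e1, if_neg e2, if_neg (by simp [h1 _ _ e1, h2 _ _ e2])]
  norm_num

/-- Random coding with threshold decoding at both receivers. -/
lemma exists_code_PeBC_le {Xc Y1 Y2 : Type*} [Fintype Xc] [Fintype Y1] [Fintype Y2]
    [DecidableEq Y1] [DecidableEq Y2] {W : Xc → Y1 × Y2 → ℝ} (hW : ∀ x, IsPMF (W x))
    {Q : Xc → ℝ} (hQ : IsPMF Q) {M0 M1 M2 : ℕ} (hM0 : 0 < M0) (hM1 : 0 < M1) (hM2 : 0 < M2)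
    (n : ℕ) {T1 T2 : ℝ} (hT1 : 0 < T1) (hT2 : 0 < T2) :
    ∃ (enc : Fin M0 × Fin M1 × Fin M2 → Fin n → Xc)
      (dec1 : (Fin n → Y1) × Fin M2 → Fin M0 × Fin M1)
      (dec2 : (Fin n → Y2) × Fin M1 → Fin M0 × Fin M2),
      PeBC W enc dec1 dec2 ≤
        (missProb (powPMF n Q) (powChan n fun a => pushPMF (W a) Prod.fst) T1
          + ((M0 * M1 - 1 : ℕ) : ℝ) / T1)
        + (missProb (powPMF n Q) (powChan n fun a => pushPMF (W a) Prod.snd) T2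
          + ((M0 * M2 - 1 : ℕ) : ℝ) / T2) := by
  classical
  have : NeZero M0 := ⟨hM0.ne'⟩
  have : NeZero M1 := ⟨hM1.ne'⟩
  have : NeZero M2 := ⟨hM2.ne'⟩
  set V1 := powChan n fun a => pushPMF (W a) (Prod.fst : Y1 × Y2 → Y1)
  set V2 := powChan n fun a => pushPMF (W a) (Prod.snd : Y1 × Y2 → Y2)
  have hQn : IsPMF (powPMF n Q) := isPMF_pi fun _ => hQ
  have hV1 : ∀ x, IsPMF (V1 x) := fun x => isPMF_pi fun i => isPMF_pushPMF (hW (x i)) _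
  have hV2 : ∀ x, IsPMF (V2 x) := fun x => isPMF_pi fun i => isPMF_pushPMF (hW (x i)) _
  let J1 : Fin M0 × Fin M1 × Fin M2 → Finset (Fin M0 × Fin M1 × Fin M2) :=
    fun m => Finset.univ.filter fun m' => m' ≠ m ∧ m'.2.2 = m.2.2
  let J2 : Fin M0 × Fin M1 × Fin M2 → Finset (Fin M0 × Fin M1 × Fin M2) :=
    fun m => Finset.univ.filter fun m' => m' ≠ m ∧ m'.2.1 = m.2.1
  have hb1 : ∀ m, missProb (powPMF n Q) V1 T1 + ((J1 m).card : ℝ) / T1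
      ≤ missProb (powPMF n Q) V1 T1 + ((M0 * M1 - 1 : ℕ) : ℝ) / T1 := by
    intro m
    have h := card_competitors_le (fun m : Fin M0 × Fin M1 × Fin M2 => m.2.2)
      (fun m => (m.1, m.2.1)) (by
        rintro ⟨a, b, c⟩ ⟨a', b', c'⟩ h h'
        simp_all) m
    simp only [Fintype.card_prod, Fintype.card_fin] at h
    have h : ((J1 m).card : ℝ) ≤ ((M0 * M1 - 1 : ℕ) : ℝ) := Nat.cast_le.2 h
    gcongr
  have hb2 : ∀ m, missProb (powPMF n Q) V2 T2 + ((J2 m).card : ℝ) / T2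
      ≤ missProb (powPMF n Q) V2 T2 + ((M0 * M2 - 1 : ℕ) : ℝ) / T2 := by
    intro m
    have h := card_competitors_le (fun m : Fin M0 × Fin M1 × Fin M2 => m.2.1)
      (fun m => (m.1, m.2.2)) (by
        rintro ⟨a, b, c⟩ ⟨a', b', c'⟩ h h'
        simp_all) m
    simp only [Fintype.card_prod, Fintype.card_fin] at h
    have h : ((J2 m).card : ℝ) ≤ ((M0 * M2 - 1 : ℕ) : ℝ) := Nat.cast_le.2 h
    gcongr
  set B1 := missProb (powPMF n Q) V1 T1 + ((M0 * M1 - 1 : ℕ) : ℝ) / T1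
  set B2 := missProb (powPMF n Q) V2 T2 + ((M0 * M2 - 1 : ℕ) : ℝ) / T2
  have hexp : ∑ enc : Fin M0 × Fin M1 × Fin M2 → Fin n → Xc, (∏ k, powPMF n Q (enc k)) *
      ((1 / ((M0 : ℝ) * M1 * M2)) * ∑ m,
        ((∑ y, V1 (enc m) y *
            (if ThresholdFails (powPMF n Q) V1 T1 enc (J1 m) m y then 1 else 0))
        + ∑ y, V2 (enc m) y *
            (if ThresholdFails (powPMF n Q) V2 T2 enc (J2 m) m y then 1 else 0))) ≤ B1 + B2 := by
    simp_rw [mul_left_comm _ (1 / ((M0 : ℝ) * M1 * M2))]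
    rw [← Finset.mul_sum]
    simp_rw [Finset.mul_sum (Finset.univ : Finset (Fin M0 × Fin M1 × Fin M2))]
    rw [Finset.sum_comm]
    have h0 : (0 : ℝ) < (M0 : ℝ) * M1 * M2 := by positivity
    rw [one_div, inv_mul_le_iff₀ h0]
    refine (Finset.sum_le_sum (g := fun _ => B1 + B2) fun m _ => ?_).trans (le_of_eq ?_)
    · have e1 := (expected_threshold_error_le hQn hV1 hT1 m (J1 m) (by simp [J1])).trans (hb1 m)
      have e2 := (expected_threshold_error_le hQn hV2 hT2 m (J2 m) (by simp [J2])).trans (hb2 m)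
      have e := add_le_add e1 e2
      rw [← Finset.sum_add_distrib] at e
      simp_rw [← mul_add] at e
      exact e
    · rw [Finset.sum_const, Finset.card_univ]
      simp only [Fintype.card_prod, Fintype.card_fin, nsmul_eq_mul, Nat.cast_mul]
      ring
  obtain ⟨enc, henc⟩ := exists_le_of_weighted_sum_le (isPMF_pi fun _ => hQn) hexp
  obtain ⟨dec1, hd1⟩ := exists_threshold_decoder (powPMF n Q) V1 T1 enc
    (fun m => m.2.2) (fun m => (m.1, m.2.1))
  obtain ⟨dec2, hd2⟩ := exists_threshold_decoder (powPMF n Q) V2 T2 enc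
    (fun m => m.2.1) (fun m => (m.1, m.2.2))
  exact ⟨enc, dec1, dec2, (PeBC_le_of_threshold hW enc dec1 dec2 _ _ hd1 hd2).trans henc⟩

end Broadcast

/-- achievability by polar codes of the capacity region of BCSI with
common message: if R₀+R₁ ≤ I(X;Y₁) and R₀+R₂ ≤ I(X;Y₂) then for every δ > 0 there is a
code with rates within δ of (R₀,R₁,R₂) and error probability at most 2^{-n^β}. -/
theorem bcsi_common_message_achievable {Y1 Y2 : Type*} [Fintype Y1] [Fintype Y2]
    [DecidableEq Y1] [DecidableEq Y2]
    (W : ZMod 2 → Y1 × Y2 → ℝ) (hW : ∀ x, IsPMF (W x))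
    (PX : ZMod 2 → ℝ) (hPX : IsPMF PX)
    (R0 R1 R2 : ℝ) (hR0 : 0 ≤ R0) (hR1 : 0 ≤ R1) (hR2 : 0 ≤ R2)
    (h1 : R0 + R1 ≤ mutInfoOf (fun xy : ZMod 2 × (Y1 × Y2) => PX xy.1 * W xy.1 xy.2)
        (fun ω => ω.1) (fun ω => ω.2.1))
    (h2 : R0 + R2 ≤ mutInfoOf (fun xy : ZMod 2 × (Y1 × Y2) => PX xy.1 * W xy.1 xy.2)
        (fun ω => ω.1) (fun ω => ω.2.2))
    (b : ℝ) (hb0 : 0 < b) (hb : b < 1 / 2) :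
    ∀ δ > 0, ∃ (n M0 M1 M2 : ℕ)
      (enc : Fin M0 × Fin M1 × Fin M2 → Fin n → ZMod 2)
      (dec1 : (Fin n → Y1) × Fin M2 → Fin M0 × Fin M1)
      (dec2 : (Fin n → Y2) × Fin M1 → Fin M0 × Fin M2),
      0 < n ∧ 0 < M0 ∧ 0 < M1 ∧ 0 < M2 ∧
      R0 - δ ≤ Real.logb 2 M0 / n ∧
      R1 - δ ≤ Real.logb 2 M1 / n ∧
      R2 - δ ≤ Real.logb 2 M2 / n ∧
      PeBC W enc dec1 dec2 ≤ Real.rpow 2 (-(Real.rpow (n : ℝ) b)) := by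
  intro δ hδ
  obtain ⟨T1, hT1, ρ1, hρ1, hρ1', hB1⟩ :=
    exists_receiver_error_bound hPX hW Prod.fst hR0 hR1 h1 hδ
  obtain ⟨T2, hT2, ρ2, hρ2, hρ2', hB2⟩ :=
    exists_receiver_error_bound hPX hW Prod.snd hR0 hR2 h2 hδ
  obtain ⟨n, hn, hn0⟩ := ((eventually_mul_pow_le_two_rpow_neg (b := b) (C := 10)
    (ρ := max ρ1 ρ2) (by linarith) (by norm_num) (lt_max_of_lt_left hρ1)
    (max_lt hρ1' hρ2')).and (Filter.eventually_gt_atTop 0)).exists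
  obtain ⟨enc, dec1, dec2, hP⟩ := exists_code_PeBC_le hW hPX (codeSize_pos R0 δ n)
    (codeSize_pos R1 δ n) (codeSize_pos R2 δ n) n (pow_pos hT1 n) (pow_pos hT2 n)
  refine ⟨n, _, _, _, enc, dec1, dec2, hn0, codeSize_pos _ _ _, codeSize_pos _ _ _,
    codeSize_pos _ _ _, le_logb_codeSize _ _ hn0, le_logb_codeSize _ _ hn0,
    le_logb_codeSize _ _ hn0, le_trans ?_ hn⟩
  have e1 := hB1 n
  have e2 := hB2 n
  have e3 := pow_le_pow_left₀ hρ1.le (le_max_left ρ1 ρ2) n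
  have e4 := pow_le_pow_left₀ hρ2.le (le_max_right ρ1 ρ2) n
  linarith
end
end

section
/- Consider the example channel with parameter p ∈ [0,1). Define random variables jointly with S as follows: V₂ ∈ {1,2,3,4} with joint pmf P(S=0, V₂=v) = (1−p)/4 for each v ∈ {1,2,3,4} and P(S=s, V₂=s) = p/4 for each s ∈ {1,2,3,4}; V₁ = 0 if V₂ ∈ {1,2} and V₁ = 1 if V₂ ∈ {3,4}; X = V₂; and Y₁, Y₂ the deterministic channel outputs of (X,S). Then I((V₁,V₂);Y₁) − I((V₁,V₂);S) = 2 − 2p and I(V₁;Y₂) − I(V₁;S) = 1 − p, and moreover I(V₂;Y₁|V₁) > I(V₂;S|V₁), I(V₁;Y₁) > I(V₁;S), and I(V₁;Y₂) > I(V₁;S). -/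
open scoped BigOperators

noncomputable section

/-- State pmf of the example channel: `P_S(0) = 1-p`, `P_S(s) = p/4` for `s ≠ 0`.
The state alphabet `{0,1,2,3,4}` is modelled by `Fin 5`. -/
def exPS (p : ℝ) : Fin 5 → ℝ := fun s => if s = 0 then 1 - p else p / 4

/-- First output of the example channel: `Y₁ = X` if `S = 0`, `Y₁ = S` otherwise.
The input/output alphabet `{1,2,3,4}` is modelled by `Fin 4` (index `i ↦ symbol i+1`),
so state symbol `s ≠ 0` corresponds to output index `s - 1`. -/
def exY1 (x : Fin 4) (s : Fin 5) : Fin 4 :=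
  if (s : ℕ) = 0 then x else ⟨(s : ℕ) - 1, by have := s.isLt; omega⟩

/-- Second output of the example channel: `Y₂ = 0` if `Y₁ ∈ {1,2}`, `Y₂ = 1` if
`Y₁ ∈ {3,4}` (i.e. output indices `{0,1}` vs `{2,3}`). -/
def exY2 (y : Fin 4) : Bool := decide (2 ≤ (y : ℕ))

/-- Joint pmf of `(S, V₂)` in the example: `P(S=0, V₂=v) = (1-p)/4` for each `v`, and
`P(S=s, V₂=s) = p/4` for `s ∈ {1,2,3,4}` (symbol `s` is index `s-1` in `Fin 4`). -/
def exQ (p : ℝ) : Fin 5 × Fin 4 → ℝ :=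
  fun ω => if ω.1 = 0 then (1 - p) / 4
    else if (ω.2 : ℕ) + 1 = (ω.1 : ℕ) then p / 4 else 0

theorem margSnd_pushPMF {Ω α β : Type*} [Fintype Ω] [Fintype α] [Fintype β] [DecidableEq α]
    [DecidableEq β] (p : Ω → ℝ) (A : Ω → α) (B : Ω → β) :
    margSnd (pushPMF p fun ω => (A ω, B ω)) = pushPMF p B := by
  funext b
  simp only [margSnd, pushPMF]
  rw [Finset.sum_comm]
  refine Finset.sum_congr rfl fun ω _ => ?_
  by_cases h : B ω = b <;> simp [Prod.ext_iff, h]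

theorem sum_pushPMF_mul {Ω α : Type*} [Fintype Ω] [Fintype α] [DecidableEq α]
    (p : Ω → ℝ) (A : Ω → α) (f : α → ℝ) :
    ∑ a, pushPMF p A a * f a = ∑ ω, p ω * f (A ω) := by
  simp only [pushPMF, Finset.sum_mul]
  rw [Finset.sum_comm]
  refine Finset.sum_congr rfl fun ω _ => ?_
  simp [ite_mul]

/-- Conditional entropy as an expectation over the underlying probability space. -/
theorem condEntOf_eq_sum {Ω α β : Type*} [Fintype Ω] [Fintype α] [Fintype β] [DecidableEq α]
    [DecidableEq β] (p : Ω → ℝ) (A : Ω → α) (B : Ω → β) :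
    condEntOf p A B = -∑ ω, p ω * Real.logb 2
      (pushPMF p (fun ω => (A ω, B ω)) (A ω, B ω) / pushPMF p B (B ω)) := by
  rw [condEntOf, condEnt, margSnd_pushPMF, ← Fintype.sum_prod_type', ← sum_pushPMF_mul p
    (fun ω => (A ω, B ω)) (fun x => Real.logb 2
      (pushPMF p (fun ω => (A ω, B ω)) x / pushPMF p B x.2))]

/-- `H(A|B) = 0` when `A` is almost surely a function of `B`. -/
theorem condEntOf_eq_zero {Ω α β : Type*} [Fintype Ω] [Fintype α] [Fintype β] [DecidableEq α]
    [DecidableEq β] (p : Ω → ℝ) (A : Ω → α) (B : Ω → β) (g : β → α)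
    (h : ∀ ω, p ω ≠ 0 → A ω = g (B ω)) : condEntOf p A B = 0 := by
  rw [condEntOf_eq_sum, neg_eq_zero]
  refine Finset.sum_eq_zero fun ω _ => ?_
  by_cases hω : p ω = 0
  · simp [hω]
  have key : pushPMF p (fun ω => (A ω, B ω)) (A ω, B ω) = pushPMF p B (B ω) := by
    refine Finset.sum_congr rfl fun η _ => ?_
    by_cases hη : p η = 0
    · simp [hη]
    by_cases hB : B η = B ω <;> simp [hB, h ω hω, h η hη]
  rw [key]
  rcases eq_or_ne (pushPMF p B (B ω)) 0 with h0 | h0 <;> simp [h0]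

theorem exY1_eq_of_exQ_ne_zero {p : ℝ} {ω : Fin 5 × Fin 4} (h : exQ p ω ≠ 0) :
    exY1 ω.2 ω.1 = ω.2 := by
  obtain ⟨s, v⟩ := ω
  by_cases hs : s = 0
  · simp [exY1, hs]
  · by_cases hv : (v : ℕ) + 1 = s
    · ext
      simp [exY1, ← hv]
    · simp [exQ, hs, hv] at h

theorem logb_div_self_eq_zero (b x : ℝ) : Real.logb b (x / x) = 0 := by
  rcases eq_or_ne x 0 with rfl | h <;> simp [*]

theorem logb_two_four : Real.logb 2 4 = 2 := by
  rw [show (4 : ℝ) = 2 ^ (2 : ℝ) by norm_num, Real.logb_rpow] <;> norm_num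

theorem condEntOf_exQ_pair_state {p : ℝ} (hp1 : p < 1) :
    condEntOf (exQ p) (fun ω => (decide (2 ≤ (ω.2 : ℕ)), ω.2)) (fun ω => ω.1) = 2 - 2 * p := by
  have h1 : 1 - p ≠ 0 := by linarith
  rw [condEntOf_eq_sum]
  have hlog : Real.logb 2 (p / 4 / (p / 4)) = 0 := logb_div_self_eq_zero 2 _
  have hr : (1 - p) / 4 / (4 * ((1 - p) / 4)) = 4⁻¹ := by
    field_simp
  simp [pushPMF, exQ, Fintype.sum_prod_type, Fin.sum_univ_succ, hlog, hr, logb_two_four]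
  ring

theorem condEntOf_exQ_bit_state {p : ℝ} (hp1 : p < 1) :
    condEntOf (exQ p) (fun ω => decide (2 ≤ (ω.2 : ℕ))) (fun ω => ω.1) = 1 - p := by
  have h1 : 1 - p ≠ 0 := by linarith
  rw [condEntOf_eq_sum]
  have hlog : Real.logb 2 (p / 4 / (p / 4)) = 0 := logb_div_self_eq_zero 2 _
  have hr : 2 * ((1 - p) / 4) / (4 * ((1 - p) / 4)) = 2⁻¹ := by
    field_simp
    norm_num
  have hr' : ((1 - p) / 4 + (1 - p) / 4) / (4 * ((1 - p) / 4)) = 2⁻¹ := by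
    field_simp
    norm_num
  simp [pushPMF, exQ, Fintype.sum_prod_type, Fin.sum_univ_succ, hlog, hr, hr']
  ring

theorem condEntOf_exQ_symbol_state_bit {p : ℝ} (hp1 : p < 1) :
    condEntOf (exQ p) (fun ω => ω.2) (fun ω => (ω.1, decide (2 ≤ (ω.2 : ℕ)))) = 1 - p := by
  have h1 : 1 - p ≠ 0 := by linarith
  rw [condEntOf_eq_sum]
  have hlog : Real.logb 2 (p / 4 / (p / 4)) = 0 := logb_div_self_eq_zero 2 _
  have hr : (1 - p) / 4 / (2 * ((1 - p) / 4)) = 2⁻¹ := by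
    field_simp
  have hr' : (1 - p) / 4 / ((1 - p) / 4 + (1 - p) / 4) = 2⁻¹ := by
    field_simp
    norm_num
  simp [pushPMF, exQ, Fintype.sum_prod_type, Fin.sum_univ_succ, hlog, hr, hr']
  ring

/-- for the example channel with the auxiliaries `V₂` (as above),
`V₁ = [V₂ ∈ {3,4}]`, `X = V₂`: `I((V₁,V₂);Y₁) − I((V₁,V₂);S) = 2 − 2p`,
`I(V₁;Y₂) − I(V₁;S) = 1 − p`, `I(V₂;Y₁|V₁) > I(V₂;S|V₁)`, `I(V₁;Y₁) > I(V₁;S)`, and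
`I(V₁;Y₂) > I(V₁;S)`. -/
theorem example_channel_aux_rates (p : ℝ) (hp0 : 0 ≤ p) (hp1 : p < 1) :
    (mutInfoOf (exQ p) (fun ω => (decide (2 ≤ (ω.2 : ℕ)), ω.2))
        (fun ω => exY1 ω.2 ω.1)
      - mutInfoOf (exQ p) (fun ω => (decide (2 ≤ (ω.2 : ℕ)), ω.2)) (fun ω => ω.1)
      = 2 - 2 * p) ∧
    (mutInfoOf (exQ p) (fun ω => decide (2 ≤ (ω.2 : ℕ))) (fun ω => exY2 (exY1 ω.2 ω.1))
      - mutInfoOf (exQ p) (fun ω => decide (2 ≤ (ω.2 : ℕ))) (fun ω => ω.1)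
      = 1 - p) ∧
    (condMutInfoOf (exQ p) (fun ω => ω.2) (fun ω => ω.1)
        (fun ω => decide (2 ≤ (ω.2 : ℕ)))
      < condMutInfoOf (exQ p) (fun ω => ω.2) (fun ω => exY1 ω.2 ω.1)
        (fun ω => decide (2 ≤ (ω.2 : ℕ)))) ∧
    (mutInfoOf (exQ p) (fun ω => decide (2 ≤ (ω.2 : ℕ))) (fun ω => ω.1)
      < mutInfoOf (exQ p) (fun ω => decide (2 ≤ (ω.2 : ℕ))) (fun ω => exY1 ω.2 ω.1)) ∧
    (mutInfoOf (exQ p) (fun ω => decide (2 ≤ (ω.2 : ℕ))) (fun ω => ω.1)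
      < mutInfoOf (exQ p) (fun ω => decide (2 ≤ (ω.2 : ℕ)))
        (fun ω => exY2 (exY1 ω.2 ω.1))) := by
  have hpair : condEntOf (exQ p) (fun ω => (decide (2 ≤ (ω.2 : ℕ)), ω.2))
      (fun ω => exY1 ω.2 ω.1) = 0 :=
    condEntOf_eq_zero _ _ _ (fun y => (decide (2 ≤ (y : ℕ)), y)) fun ω h => by
      simp only [exY1_eq_of_exQ_ne_zero h]
  have hbit₁ : condEntOf (exQ p) (fun ω => decide (2 ≤ (ω.2 : ℕ)))
      (fun ω => exY1 ω.2 ω.1) = 0 :=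
    condEntOf_eq_zero _ _ _ (fun y => decide (2 ≤ (y : ℕ))) fun ω h => by
      simp only [exY1_eq_of_exQ_ne_zero h]
  have hbit₂ : condEntOf (exQ p) (fun ω => decide (2 ≤ (ω.2 : ℕ)))
      (fun ω => exY2 (exY1 ω.2 ω.1)) = 0 :=
    condEntOf_eq_zero _ _ _ id fun ω h => by
      simp only [exY1_eq_of_exQ_ne_zero h, exY2, id]
  have hsym : condEntOf (exQ p) (fun ω => ω.2)
      (fun ω => (exY1 ω.2 ω.1, decide (2 ≤ (ω.2 : ℕ)))) = 0 :=
    condEntOf_eq_zero _ _ _ Prod.fst fun ω h => (exY1_eq_of_exQ_ne_zero h).symm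
  simp only [mutInfoOf, condMutInfoOf, hpair, hbit₁, hbit₂, hsym, condEntOf_exQ_pair_state hp1,
    condEntOf_exQ_bit_state hp1, condEntOf_exQ_symbol_state_bit hp1]
  refine ⟨?_, ?_, ?_, ?_, ?_⟩ <;> linarith
end
end

section
/- Let X, S, Y be finite sets, P_S a pmf on S, and W a channel with W(·|x,s) a pmf on Y for each (x,s). Suppose there exist a finite set U, a conditional pmf P_{U|S}, and a function f : U × S → X such that, under the joint pmf P_S(s)·P_{U|S}(u|s)·W(y| f(u,s), s), I(U;Y) − I(U;S) > 0. Then there exist a finite set V, a pmf P_V on V, and a function g : V × S → X such that, under the joint pmf P_V(v)·P_S(s)·W(y| g(v,s), s) (so V is independent of S), I(V;Y) > 0. -/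
open scoped BigOperators

noncomputable section

lemma pushPMF_fst {A B C : Type*} [Fintype A] [Fintype B] [Fintype C]
    [DecidableEq A] (p : A × B × C → ℝ) (a : A) :
    pushPMF p (fun ω => ω.1) a = ∑ b, ∑ c, p (a, b, c) := by
  simp only [pushPMF, Fintype.sum_prod_type]
  rw [Finset.sum_eq_single a (by intro a' _ h; simp [h]) (by simp)]
  simp

lemma pushPMF_fst_snd {A B C : Type*} [Fintype A] [Fintype B] [Fintype C]
    [DecidableEq A] [DecidableEq B] (p : A × B × C → ℝ) (a : A) (b : B) :
    pushPMF p (fun ω => (ω.1, ω.2.1)) (a, b) = ∑ c, p (a, b, c) := by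
  simp only [pushPMF, Fintype.sum_prod_type, Prod.mk.injEq]
  rw [Finset.sum_eq_single a (by intro a' _ h; simp [h]) (by simp),
    Finset.sum_eq_single b (by intro b' _ h; simp [h]) (by simp)]
  simp

lemma pushPMF_fst_trd {A B C : Type*} [Fintype A] [Fintype B] [Fintype C]
    [DecidableEq A] [DecidableEq C] (p : A × B × C → ℝ) (a : A) (c : C) :
    pushPMF p (fun ω => (ω.1, ω.2.2)) (a, c) = ∑ b, p (a, b, c) := by
  simp only [pushPMF, Fintype.sum_prod_type, Prod.mk.injEq]
  rw [Finset.sum_eq_single a (by intro a' _ h; simp [h]) (by simp)]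
  simp

/-- A form of the log-sum inequality. -/
lemma sum_mul_mul_logb_div_le {ι : Type*} [Fintype ι] (b x : ι → ℝ)
    (hb : ∀ i, 0 ≤ b i) (hx : ∀ i, 0 ≤ x i) :
    (∑ i, b i * x i) * Real.logb 2 ((∑ i, b i * x i) / ∑ i, b i) ≤
      ∑ i, b i * (x i * Real.logb 2 (x i)) := by
  rcases (Finset.sum_nonneg fun i _ => hb i).eq_or_lt with h0 | hpos
  · have hz : ∀ i, b i = 0 := fun i =>
      (Finset.sum_eq_zero_iff_of_nonneg fun i _ => hb i).1 h0.symm i (Finset.mem_univ i)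
    simp [hz]
  have hl : 0 < Real.log 2 := Real.log_pos one_lt_two
  have key := Real.convexOn_mul_log.map_centerMass_le (t := Finset.univ) (w := b) (p := x)
    (fun i _ => hb i) hpos (fun i _ => hx i)
  simp only [Finset.centerMass, smul_eq_mul, Function.comp_def, inv_mul_eq_div] at key
  rw [div_mul_eq_mul_div, div_le_div_iff_of_pos_right hpos] at key
  simp only [Real.logb, mul_div_assoc']
  rw [← Finset.sum_div]
  exact div_le_div_of_nonneg_right key hl.le

/-- Data processing: conditioning on a noisy version of `S` increases conditional entropy. -/
lemma condEnt_le_condEnt_of_markov {A B C : Type*} [Fintype A] [Fintype B] [Fintype C]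
    (a : A × B → ℝ) (ha : ∀ z, 0 ≤ a z) (k : B → C → ℝ) (hk : ∀ b, IsPMF (k b)) :
    condEnt a ≤ condEnt (fun z : A × C => ∑ b, a (z.1, b) * k b z.2) := by
  have hm : ∀ b, 0 ≤ margSnd a b := fun b => Finset.sum_nonneg fun _ _ => ha _
  have hdiv : ∀ u b, margSnd a b * (a (u, b) / margSnd a b) = a (u, b) := by
    intro u b
    rcases (hm b).eq_or_lt with h0 | hpos
    · have : a (u, b) = 0 :=
        (Finset.sum_eq_zero_iff_of_nonneg fun i _ => ha (i, b)).1 h0.symm u (Finset.mem_univ u)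
      simp [this]
    · field_simp
  have hmarg : ∀ c, margSnd (fun z : A × C => ∑ b, a (z.1, b) * k b z.2) c =
      ∑ b, margSnd a b * k b c := by
    intro c
    simp only [margSnd]
    rw [Finset.sum_comm]
    simp only [Finset.sum_mul]
  unfold condEnt
  refine neg_le_neg (Finset.sum_le_sum fun u _ => ?_)
  calc ∑ c, (∑ b, a (u, b) * k b c) * Real.logb 2 ((∑ b, a (u, b) * k b c) /
          margSnd (fun z : A × C => ∑ b, a (z.1, b) * k b z.2) c)
      ≤ ∑ c, ∑ b, k b c * (a (u, b) * Real.logb 2 (a (u, b) / margSnd a b)) := by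
        refine Finset.sum_le_sum fun c _ => ?_
        have key := sum_mul_mul_logb_div_le (fun b => margSnd a b * k b c)
          (fun b => a (u, b) / margSnd a b) (fun b => mul_nonneg (hm b) ((hk b).1 c))
          (fun b => div_nonneg (ha _) (hm b))
        have e : ∀ b, margSnd a b * k b c * (a (u, b) / margSnd a b) = a (u, b) * k b c := by
          intro b
          rw [mul_right_comm, hdiv]
        simp only [← mul_assoc, e] at key
        rw [hmarg]
        refine key.trans (le_of_eq (Finset.sum_congr rfl fun b _ => ?_))
        ring
    _ = ∑ b, a (u, b) * Real.logb 2 (a (u, b) / margSnd a b) := by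
        rw [Finset.sum_comm]
        refine Finset.sum_congr rfl fun b _ => ?_
        rw [← Finset.sum_mul, (hk b).2, one_mul]

lemma neg_half_mul_logb_eq_binEntropy {p q : ℝ} (hpq : 0 < p + q) :
    -(p / 2 * Real.logb 2 (p / 2 / (p / 2 + q / 2)) +
        q / 2 * Real.logb 2 (q / 2 / (p / 2 + q / 2))) =
      (p + q) / 2 * (Real.binEntropy (p / (p + q)) / Real.log 2) := by
  have hp : p / 2 / (p / 2 + q / 2) = p / (p + q) := by field_simp
  have hq : q / 2 / (p / 2 + q / 2) = q / (p + q) := by field_simp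
  have h1 : 1 - p / (p + q) = q / (p + q) := by field_simp; ring
  rw [hp, hq, Real.binEntropy, h1, Real.log_inv, Real.log_inv]
  simp only [Real.logb]
  field_simp
  ring

lemma neg_half_mul_logb_le {p q : ℝ} (hp : 0 ≤ p) (hq : 0 ≤ q) :
    -(p / 2 * Real.logb 2 (p / 2 / (p / 2 + q / 2)) +
        q / 2 * Real.logb 2 (q / 2 / (p / 2 + q / 2))) ≤ (p + q) / 2 := by
  rcases (add_nonneg hp hq).eq_or_lt with h0 | hpos
  · obtain ⟨rfl, rfl⟩ := (add_eq_zero_iff_of_nonneg hp hq).1 h0.symm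
    simp
  · rw [neg_half_mul_logb_eq_binEntropy hpos]
    refine mul_le_of_le_one_right (by positivity) ?_
    rw [div_le_one (Real.log_pos one_lt_two)]
    exact Real.binEntropy_le_log_two

lemma neg_half_mul_logb_lt {p q : ℝ} (hp : 0 ≤ p) (hq : 0 ≤ q) (hne : p ≠ q) :
    -(p / 2 * Real.logb 2 (p / 2 / (p / 2 + q / 2)) +
        q / 2 * Real.logb 2 (q / 2 / (p / 2 + q / 2))) < (p + q) / 2 := by
  have hpos : 0 < p + q := by
    rcases (add_nonneg hp hq).eq_or_lt with h0 | hpos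
    · obtain ⟨rfl, rfl⟩ := (add_eq_zero_iff_of_nonneg hp hq).1 h0.symm
      exact absurd rfl hne
    · exact hpos
  rw [neg_half_mul_logb_eq_binEntropy hpos]
  refine mul_lt_of_lt_one_right (by positivity) ?_
  rw [div_lt_one (Real.log_pos one_lt_two), Real.binEntropy_lt_log_two]
  intro h
  rw [div_eq_iff hpos.ne'] at h
  exact hne (by linarith)

/-- A uniform bit has less than one bit of entropy given the output of a channel that
distinguishes its two values. -/
lemma condEnt_uniform_lt_one {C : Type*} [Fintype C] (Q : Fin 2 → C → ℝ)
    (hQ : ∀ v, IsPMF (Q v)) (hne : Q 0 ≠ Q 1) :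
    condEnt (fun z : Fin 2 × C => Q z.1 z.2 / 2) < 1 := by
  obtain ⟨c₀, hc₀⟩ := Function.ne_iff.1 hne
  have hsum : ∑ c, (Q 0 c + Q 1 c) / 2 = 1 := by
    rw [← Finset.sum_div, Finset.sum_add_distrib, (hQ 0).2, (hQ 1).2]
    norm_num
  simp only [condEnt, margSnd, Fin.sum_univ_two]
  rw [← Finset.sum_add_distrib, ← Finset.sum_neg_distrib, ← hsum]
  exact Finset.sum_lt_sum (fun c _ => neg_half_mul_logb_le ((hQ 0).1 c) ((hQ 1).1 c))
    ⟨c₀, Finset.mem_univ _, neg_half_mul_logb_lt ((hQ 0).1 c₀) ((hQ 1).1 c₀) hc₀⟩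

/-- The law of the output when the encoder uses the strategy `g : S → X`. -/
lemma isPMF_strategy_output {X S Y : Type*} [Fintype S] [Fintype Y] {PS : S → ℝ}
    (hPS : IsPMF PS) {W : X → S → Y → ℝ} (hW : ∀ x s, IsPMF (W x s)) (g : S → X) :
    IsPMF (fun y => ∑ s, PS s * W (g s) s y) := by
  refine ⟨fun y => Finset.sum_nonneg fun s _ => mul_nonneg (hPS.1 s) ((hW _ s).1 y), ?_⟩
  rw [Finset.sum_comm]
  simp only [← Finset.mul_sum, (hW _ _).2, mul_one, hPS.2]

/-- Two strategies with different output laws give a positive causal rate. -/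
lemma mutInfoOf_pos_of_strategies_ne {X S Y : Type*} [Fintype S] [Fintype Y]
    [DecidableEq S] [DecidableEq Y] {PS : S → ℝ}
    (hPS : IsPMF PS) {W : X → S → Y → ℝ} (hW : ∀ x s, IsPMF (W x s)) (g : Fin 2 → S → X)
    (hne : (fun y => ∑ s, PS s * W (g 0 s) s y) ≠ fun y => ∑ s, PS s * W (g 1 s) s y) :
    0 < mutInfoOf (fun ω : Fin 2 × S × Y => 1 / 2 * PS ω.2.1 * W (g ω.1 ω.2.1) ω.2.1 ω.2.2)
      (fun ω => ω.1) (fun ω => ω.2.2) := by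
  have hlt := condEnt_uniform_lt_one (fun v y => ∑ s, PS s * W (g v s) s y)
    (fun v => isPMF_strategy_output hPS hW (g v)) hne
  have hjoint : pushPMF (fun ω : Fin 2 × S × Y =>
      1 / 2 * PS ω.2.1 * W (g ω.1 ω.2.1) ω.2.1 ω.2.2) (fun ω => (ω.1, ω.2.2)) =
      fun z => (∑ s, PS s * W (g z.1 s) s z.2) / 2 := by
    ext ⟨v, y⟩
    rw [pushPMF_fst_trd, Finset.sum_div]
    exact Finset.sum_congr rfl fun s _ => by ring
  have hfst : pushPMF (fun ω : Fin 2 × S × Y =>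
      1 / 2 * PS ω.2.1 * W (g ω.1 ω.2.1) ω.2.1 ω.2.2) (fun ω => ω.1) = fun _ => 1 / 2 := by
    ext v
    rw [pushPMF_fst]
    simp only [← Finset.mul_sum, (hW _ _).2, mul_one, hPS.2]
  have hent : ent (fun _ : Fin 2 => (1 / 2 : ℝ)) = 1 := by
    simp [ent]
  rw [mutInfoOf, entOf, condEntOf, hjoint, hfst, hent]
  exact sub_pos.2 hlt

/-- Lemma 1: if the Gelfand–Pinsker objective is positive for some
finite auxiliary `U` with conditional pmf `P_{U|S}` and input map `f`, then the
causal-state objective is positive for some finite `V` independent of `S` with pmf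
`P_V` and input map `g`, i.e. `I(V;Y) > 0`. -/
theorem gelfand_pinsker_pos_implies_causal_pos
    {Xc Sc Yc : Type*} [Fintype Xc] [Fintype Sc] [Fintype Yc]
    [DecidableEq Xc] [DecidableEq Sc] [DecidableEq Yc]
    (PS : Sc → ℝ) (hPS : IsPMF PS)
    (W : Xc → Sc → Yc → ℝ) (hW : ∀ x s, IsPMF (W x s))
    (U : Type) [Fintype U] [DecidableEq U]
    (PU : Sc → U → ℝ) (hPU : ∀ s, IsPMF (PU s))
    (f : U → Sc → Xc)
    (h : 0 < mutInfoOf (fun ω : U × Sc × Yc =>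
            PS ω.2.1 * PU ω.2.1 ω.1 * W (f ω.1 ω.2.1) ω.2.1 ω.2.2)
          (fun ω => ω.1) (fun ω => ω.2.2)
        - mutInfoOf (fun ω : U × Sc × Yc =>
            PS ω.2.1 * PU ω.2.1 ω.1 * W (f ω.1 ω.2.1) ω.2.1 ω.2.2)
          (fun ω => ω.1) (fun ω => ω.2.1)) :
    ∃ (m : ℕ) (PV : Fin m → ℝ) (g : Fin m → Sc → Xc),
      IsPMF PV ∧
      0 < mutInfoOf (fun ω : Fin m × Sc × Yc =>
            PV ω.1 * PS ω.2.1 * W (g ω.1 ω.2.1) ω.2.1 ω.2.2)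
          (fun ω => ω.1) (fun ω => ω.2.2) := by
  have hPU0 : ∀ z : U × Sc, 0 ≤ PS z.2 * PU z.2 z.1 := fun z =>
    mul_nonneg (hPS.1 z.2) ((hPU z.2).1 z.1)
  by_cases hex : ∃ s x x', PS s ≠ 0 ∧ W x s ≠ W x' s
  · obtain ⟨s₀, x, x', hs₀, hne⟩ := hex
    refine ⟨2, fun _ => 1 / 2, ![fun _ => x, Function.update (fun _ => x) s₀ x'],
      ⟨fun _ => by norm_num, by simp⟩, mutInfoOf_pos_of_strategies_ne hPS hW _ ?_⟩
    intro heq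
    refine hne (funext fun y => ?_)
    have hy := congrFun heq y
    simp only [Matrix.cons_val_zero, Matrix.cons_val_one] at hy
    rw [← Finset.add_sum_erase _ _ (Finset.mem_univ s₀),
      ← Finset.add_sum_erase _ _ (Finset.mem_univ s₀), Function.update_self,
      Finset.sum_congr rfl (g := fun s => PS s * W (Function.update (fun _ => x) s₀ x' s) s y)
        fun s hs => by rw [Function.update_of_ne (Finset.ne_of_mem_erase hs)]] at hy
    exact mul_left_cancel₀ hs₀ (add_right_cancel hy)
  · exfalso
    push Not at hex
    obtain ⟨s₁, -, -⟩ := Finset.exists_ne_zero_of_sum_ne_zero (hPS.2.trans_ne one_ne_zero)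
    obtain ⟨u₀, -, -⟩ := Finset.exists_ne_zero_of_sum_ne_zero ((hPU s₁).2.trans_ne one_ne_zero)
    have hle := condEnt_le_condEnt_of_markov (fun z : U × Sc => PS z.2 * PU z.2 z.1) hPU0
      (fun s => W (f u₀ s) s) (fun s => hW _ s)
    have hUS : pushPMF (fun ω : U × Sc × Yc =>
        PS ω.2.1 * PU ω.2.1 ω.1 * W (f ω.1 ω.2.1) ω.2.1 ω.2.2) (fun ω => (ω.1, ω.2.1)) =
        fun z => PS z.2 * PU z.2 z.1 := by
      ext ⟨u, s⟩
      rw [pushPMF_fst_snd]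
      simp only [← Finset.mul_sum, (hW _ _).2, mul_one]
    have hUY : pushPMF (fun ω : U × Sc × Yc =>
        PS ω.2.1 * PU ω.2.1 ω.1 * W (f ω.1 ω.2.1) ω.2.1 ω.2.2) (fun ω => (ω.1, ω.2.2)) =
        fun z => ∑ s, PS s * PU s z.1 * W (f u₀ s) s z.2 := by
      ext ⟨u, y⟩
      rw [pushPMF_fst_trd]
      refine Finset.sum_congr rfl fun s _ => ?_
      by_cases hs : PS s = 0
      · simp [hs]
      · simp only [hex s (f u s) (f u₀ s) hs]
    simp only [mutInfoOf, condEntOf, hUS, hUY] at h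
    linarith
end
end

section
/- Let X, S, Y be finite sets, P_S a pmf on S, and W a channel with W(·|x,s) a pmf on Y for each (x,s). Suppose there exist y₁ ∈ Y, s₁ ∈ S with P_S(s₁) > 0, and x₁, x₂ ∈ X with x₁ ≠ x₂ and W(y₁|x₁,s₁) ≠ W(y₁|x₂,s₁). Let U = {u₁, u₂} with the uniform pmf, let c ∈ X be arbitrary, and define f : U × S → X by f(u₁,s₁) = x₁, f(u₂,s₁) = x₂, and f(u₁,s) = f(u₂,s) = c for all s ≠ s₁. Then, under the joint pmf (1/2)·P_S(s)·W(y| f(u,s), s), the conditional output distributions satisfy P_{Y|U}(y₁|u₁) ≠ P_{Y|U}(y₁|u₂); in particular U and Y are not independent and I(U;Y) > 0. -/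
open scoped BigOperators

noncomputable section

/-- The joint pmf of `(U, S, Y)` when `U` is uniform on the two-element set
(modelled by `Bool`, `false ↦ u₁`, `true ↦ u₂`), `S ∼ P_S` independent of `U`, the
input is `X = f(U,S)`, and `Y ∼ W(·|X,S)`. -/
def st11Q {Xc Sc Yc : Type*} (PS : Sc → ℝ) (W : Xc → Sc → Yc → ℝ)
    (f : Bool → Sc → Xc) : Bool × Sc × Yc → ℝ :=
  fun ω => (1 / 2) * PS ω.2.1 * W (f ω.1 ω.2.1) ω.2.1 ω.2.2

/-- Marginalizing the joint law of `(A, B)` gives the law of `A`. -/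
theorem margFst_pushPMF {Ω α β : Type*} [Fintype Ω] [Fintype α] [Fintype β]
    [DecidableEq α] [DecidableEq β] (p : Ω → ℝ) (A : Ω → α) (B : Ω → β) :
    margFst (pushPMF p (fun ω => (A ω, B ω))) = pushPMF p A := by
  funext a
  simp only [margFst, pushPMF, Prod.mk.injEq]
  rw [Finset.sum_comm]
  refine Finset.sum_congr rfl fun ω _ => ?_
  by_cases h : A ω = a <;> simp [h]

theorem mutInfoOf_eq_mutInfo {Ω α β : Type*} [Fintype Ω] [Fintype α] [Fintype β]
    [DecidableEq α] [DecidableEq β] (p : Ω → ℝ) (A : Ω → α) (B : Ω → β) :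
    mutInfoOf p A B = mutInfo (pushPMF p (fun ω => (A ω, B ω))) := by
  rw [mutInfoOf, mutInfo, margFst_pushPMF, entOf, condEntOf]

theorem IsPMF.sum_margFst {α β : Type*} [Fintype α] [Fintype β] {q : α × β → ℝ}
    (hq : IsPMF q) : ∑ a, margFst q a = 1 := by
  simpa [margFst, Fintype.sum_prod_type] using hq.2

theorem IsPMF.sum_margSnd {α β : Type*} [Fintype α] [Fintype β] {q : α × β → ℝ}
    (hq : IsPMF q) : ∑ b, margSnd q b = 1 := by
  simpa [margSnd, Fintype.sum_prod_type_right] using hq.2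

/-- Mutual information as a single double sum. -/
theorem mutInfo_eq_sum {α β : Type*} [Fintype α] [Fintype β] (q : α × β → ℝ) :
    mutInfo q = ∑ x : α × β,
      (q x * Real.logb 2 (q x / margSnd q x.2) - q x * Real.logb 2 (margFst q x.1)) := by
  rw [Finset.sum_sub_distrib, Fintype.sum_prod_type, Fintype.sum_prod_type, mutInfo, ent, condEnt]
  have h : ∀ a, ∑ b, q (a, b) * Real.logb 2 (margFst q a)
      = margFst q a * Real.logb 2 (margFst q a) := fun a => by
    rw [← Finset.sum_mul, margFst]
  simp only [h]
  ring

/-- Strict case of Gibbs' inequality for one term. -/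
theorem sub_mul_div_log_two_lt {q r s : ℝ} (hq : 0 ≤ q) (hr : q ≤ r) (hs : q ≤ s)
    (hne : q ≠ r * s) :
    (q - r * s) / Real.log 2 < q * Real.logb 2 (q / s) - q * Real.logb 2 r := by
  have h2 : 0 < Real.log 2 := Real.log_pos one_lt_two
  rcases hq.eq_or_lt with rfl | hq
  · have := lt_of_le_of_ne (mul_nonneg hr hs) hne
    simp only [zero_mul, sub_zero, zero_sub]
    exact div_neg_of_neg_of_pos (by linarith) h2
  · have hr' : 0 < r := hq.trans_le hr
    have hs' : 0 < s := hq.trans_le hs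
    have h := Real.log_lt_sub_one_of_pos (show 0 < r * s / q by positivity)
      (fun h => hne ((div_eq_one_iff_eq hq.ne').1 h).symm)
    have e : q * Real.logb 2 (q / s) - q * Real.logb 2 r
        = (q * -Real.log (r * s / q)) / Real.log 2 := by
      rw [Real.logb, Real.logb, Real.log_div hq.ne' hs'.ne',
        Real.log_div (by positivity) hq.ne', Real.log_mul hr'.ne' hs'.ne']
      ring
    rw [e]
    gcongr
    have := mul_lt_mul_of_pos_left h hq
    rw [mul_sub, mul_div_cancel₀ _ hq.ne'] at this
    linarith

/-- Gibbs' inequality for one term. -/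
theorem sub_mul_div_log_two_le {q r s : ℝ} (hq : 0 ≤ q) (hr : q ≤ r) (hs : q ≤ s) :
    (q - r * s) / Real.log 2 ≤ q * Real.logb 2 (q / s) - q * Real.logb 2 r := by
  by_cases hne : q = r * s
  · rcases hq.eq_or_lt with rfl | hpos
    · simp [← hne]
    · rw [(div_eq_iff (hpos.trans_le hs).ne').2 hne, ← hne]
      simp
  · exact (sub_mul_div_log_two_lt hq hr hs hne).le

/-- Mutual information is positive unless the joint pmf is the product of its marginals. -/
theorem mutInfo_pos {α β : Type*} [Fintype α] [Fintype β] {q : α × β → ℝ} (hq : IsPMF q)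
    (hne : ¬ ∀ a b, q (a, b) = margFst q a * margSnd q b) : 0 < mutInfo q := by
  have hr : ∀ x, q x ≤ margFst q x.1 := fun x =>
    Finset.single_le_sum (f := fun b => q (x.1, b)) (fun b _ => hq.1 _) (Finset.mem_univ x.2)
  have hs : ∀ x, q x ≤ margSnd q x.2 := fun x =>
    Finset.single_le_sum (f := fun a => q (a, x.2)) (fun a _ => hq.1 _) (Finset.mem_univ x.1)
  have h0 : ∑ x : α × β, (q x - margFst q x.1 * margSnd q x.2) / Real.log 2 = 0 := by
    rw [← Finset.sum_div, Finset.sum_sub_distrib, hq.2, Fintype.sum_prod_type]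
    simp only [← Finset.mul_sum, hq.sum_margSnd, mul_one, hq.sum_margFst, sub_self, zero_div]
  push Not at hne
  obtain ⟨a, b, hab⟩ := hne
  rw [mutInfo_eq_sum, ← h0]
  exact Finset.sum_lt_sum (fun x _ => sub_mul_div_log_two_le (hq.1 x) (hr x) (hs x))
    ⟨(a, b), Finset.mem_univ _, sub_mul_div_log_two_lt (hq.1 _) (hr (a, b)) (hs (a, b)) hab⟩

/-- The joint law of `(U, Y)` under `st11Q`. -/
theorem pushPMF_st11Q {Xc Sc Yc : Type*} [Fintype Sc] [Fintype Yc] [DecidableEq Yc]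
    (PS : Sc → ℝ) (W : Xc → Sc → Yc → ℝ) (f : Bool → Sc → Xc) (u : Bool) (y : Yc) :
    pushPMF (st11Q PS W f) (fun ω => (ω.1, ω.2.2)) (u, y)
      = 1 / 2 * ∑ s, PS s * W (f u s) s y := by
  simp only [pushPMF, st11Q, Fintype.sum_prod_type, Prod.mk.injEq, Finset.mul_sum]
  rw [Finset.sum_eq_single u (fun v _ hv => by simp [hv]) (by simp)]
  simp [mul_assoc]

theorem margFst_pushPMF_st11Q {Xc Sc Yc : Type*} [Fintype Sc] [Fintype Yc] [DecidableEq Yc]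
    {PS : Sc → ℝ} (hPS : IsPMF PS) {W : Xc → Sc → Yc → ℝ} (hW : ∀ x s, IsPMF (W x s))
    (f : Bool → Sc → Xc) (u : Bool) :
    margFst (pushPMF (st11Q PS W f) (fun ω => (ω.1, ω.2.2))) u = 1 / 2 := by
  simp only [margFst, pushPMF_st11Q]
  rw [← Finset.mul_sum, Finset.sum_comm]
  simp only [← Finset.mul_sum, (hW _ _).2, mul_one, hPS.2]

theorem isPMF_pushPMF_st11Q {Xc Sc Yc : Type*} [Fintype Sc] [Fintype Yc] [DecidableEq Yc]
    {PS : Sc → ℝ} (hPS : IsPMF PS) {W : Xc → Sc → Yc → ℝ} (hW : ∀ x s, IsPMF (W x s))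
    (f : Bool → Sc → Xc) :
    IsPMF (pushPMF (st11Q PS W f) (fun ω => (ω.1, ω.2.2))) := by
  refine ⟨fun ⟨u, y⟩ => ?_, ?_⟩
  · rw [pushPMF_st11Q]
    exact mul_nonneg (by norm_num)
      (Finset.sum_nonneg fun s _ => mul_nonneg (hPS.1 s) ((hW _ s).1 y))
  · have h := margFst_pushPMF_st11Q hPS hW f
    simp only [margFst] at h
    rw [Fintype.sum_prod_type]
    simp only [h]
    norm_num

/-- if `W(y₁|x₁,s₁) ≠ W(y₁|x₂,s₁)` for some state `s₁` of positive
probability, then with `U` uniform on `{u₁,u₂}` and `f` as described (equal to the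
given values at `s₁` and constant `c` elsewhere), the conditional output
distributions differ at `y₁`, `U` and `Y` are not independent, and `I(U;Y) > 0`. -/
theorem causal_state_positive_info
    {Xc Sc Yc : Type*} [Fintype Xc] [Fintype Sc] [Fintype Yc]
    [DecidableEq Xc] [DecidableEq Sc] [DecidableEq Yc]
    (PS : Sc → ℝ) (hPS : IsPMF PS)
    (W : Xc → Sc → Yc → ℝ) (hW : ∀ x s, IsPMF (W x s))
    (y1 : Yc) (s1 : Sc) (hs1 : 0 < PS s1)
    (x1 x2 : Xc) (hx : x1 ≠ x2) (hne : W x1 s1 y1 ≠ W x2 s1 y1)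
    (c : Xc) (f : Bool → Sc → Xc)
    (hf1 : f false s1 = x1) (hf2 : f true s1 = x2)
    (hfc : ∀ s, s ≠ s1 → f false s = c ∧ f true s = c) :
    (pushPMF (st11Q PS W f) (fun ω => (ω.1, ω.2.2)) (false, y1)
        / margFst (pushPMF (st11Q PS W f) (fun ω => (ω.1, ω.2.2))) false
      ≠ pushPMF (st11Q PS W f) (fun ω => (ω.1, ω.2.2)) (true, y1)
        / margFst (pushPMF (st11Q PS W f) (fun ω => (ω.1, ω.2.2))) true) ∧
    (¬ ∀ (u : Bool) (y : Yc),
        pushPMF (st11Q PS W f) (fun ω => (ω.1, ω.2.2)) (u, y)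
          = margFst (pushPMF (st11Q PS W f) (fun ω => (ω.1, ω.2.2))) u
            * margSnd (pushPMF (st11Q PS W f) (fun ω => (ω.1, ω.2.2))) y) ∧
    0 < mutInfoOf (st11Q PS W f) (fun ω => ω.1) (fun ω => ω.2.2) := by
  have hm := margFst_pushPMF_st11Q hPS hW f
  have hjoint : pushPMF (st11Q PS W f) (fun ω => (ω.1, ω.2.2)) (false, y1)
      ≠ pushPMF (st11Q PS W f) (fun ω => (ω.1, ω.2.2)) (true, y1) := by
    rw [pushPMF_st11Q, pushPMF_st11Q]
    intro h
    have h' := mul_left_cancel₀ (by norm_num) h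
    rw [← Finset.add_sum_erase _ _ (Finset.mem_univ s1),
      ← Finset.add_sum_erase _ _ (Finset.mem_univ s1), hf1, hf2,
      Finset.sum_congr rfl (fun s hs => by
        rw [(hfc s (Finset.ne_of_mem_erase hs)).1, ← (hfc s (Finset.ne_of_mem_erase hs)).2])] at h'
    exact hne (mul_left_cancel₀ hs1.ne' (add_right_cancel h'))
  have hind : ¬ ∀ (u : Bool) (y : Yc),
      pushPMF (st11Q PS W f) (fun ω => (ω.1, ω.2.2)) (u, y)
        = margFst (pushPMF (st11Q PS W f) (fun ω => (ω.1, ω.2.2))) u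
          * margSnd (pushPMF (st11Q PS W f) (fun ω => (ω.1, ω.2.2))) y := fun h =>
    hjoint (by rw [h false y1, h true y1, hm, hm])
  refine ⟨?_, hind, ?_⟩
  · rw [hm, hm]
    exact fun h => hjoint (by linarith)
  · rw [mutInfoOf_eq_mutInfo]
    exact mutInfo_pos (isPMF_pushPMF_st11Q hPS hW f) hind
end
end
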